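/- arXiv:2006.15638 — 7 statements merged into one kernel-verified Lean document; each statement's English description precedes it below -/
import Mathlib

section
/- For any fixed τ ≥ 0 and any vector μ ∈ ℝ^K, the model-misspecification (squared-bias) term of the MSPE decomposition is minimized over weight vectors by the BPE weights: μᵀU_{w^{bpe}(τ),τ}ᵀU_{w^{bpe}(τ),τ}μ ≤ μᵀU_{w,τ}ᵀU_{w,τ}μ for every admissible weight vector w, where w^{bpe}(τ) is the weight vector with entries proportional to B_{k,τ}². -/
open Matrix

lemma quad_aux {K : ℕ} (B : Fin K → ℝ) (N : Matrix (Fin K) (Fin K) ℝ) (m : Fin K → ℝ) :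
    m ⬝ᵥ (((Matrix.diagonal B * N)ᵀ * (Matrix.diagonal B * N)) *ᵥ m)
      = ∑ k, B k ^ 2 * (N *ᵥ m) k ^ 2 := by
  rw [← Matrix.mulVec_mulVec, Matrix.dotProduct_mulVec, Matrix.vecMul_transpose,
    ← Matrix.mulVec_mulVec]
  simp only [dotProduct, Matrix.mulVec_diagonal]
  refine Finset.sum_congr rfl fun k _ => ?_
  ring

/-- For fixed `τ ≥ 0` and any `μ ∈ ℝ^K`, the squared-bias term of the MSPE
decomposition is minimized over admissible weight vectors by the BPE weights. -/
theorem bpe_weights_minimize_bias_term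
    {K p : ℕ} (hK : 1 ≤ K)
    (σ2 : Fin K → ℝ) (hσ2 : ∀ k, 0 < σ2 k)
    (τ : ℝ) (hτ : 0 ≤ τ)
    (X : Matrix (Fin K) (Fin p) ℝ) (hX : X.rank = p)
    (μvec : Fin K → ℝ)
    (B : Fin K → ℝ) (hB : ∀ k, B k = σ2 k / (σ2 k + τ ^ 2))
    (Bτ : Matrix (Fin K) (Fin K) ℝ) (hBτ : Bτ = Matrix.diagonal B)
    (U : (Fin K → ℝ) → Matrix (Fin K) (Fin K) ℝ)
    (hU : ∀ w, U w =
      Bτ * (X * (Xᵀ * Matrix.diagonal w * X)⁻¹ * Xᵀ * Matrix.diagonal w - 1))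
    (wbpe : Fin K → ℝ) (hwbpe : ∀ k, wbpe k = B k ^ 2 / ∑ j, B j ^ 2) :
    ∀ w : Fin K → ℝ, (∀ k, 0 ≤ w k) → IsUnit (Xᵀ * Matrix.diagonal w * X) →
      μvec ⬝ᵥ (((U wbpe)ᵀ * U wbpe) *ᵥ μvec) ≤
        μvec ⬝ᵥ (((U w)ᵀ * U w) *ᵥ μvec) := by
  intro w _ hw
  subst hBτ
  have hBpos : ∀ k, 0 < B k := fun k => by
    rw [hB]; have := hσ2 k; positivity
  have hS : 0 < ∑ j, B j ^ 2 :=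
    Finset.sum_pos (fun k _ => pow_pos (hBpos k) 2) ⟨⟨0, hK⟩, Finset.mem_univ _⟩
  have hw0 : ∀ k, 0 < wbpe k := fun k => by
    rw [hwbpe]; exact div_pos (pow_pos (hBpos k) 2) hS
  have hBw : ∀ k, B k ^ 2 = (∑ j, B j ^ 2) * wbpe k := fun k => by
    rw [hwbpe]; field_simp
  have hXinj : ∀ v, X *ᵥ v = 0 → v = 0 := fun v hv => by
    apply Matrix.mulVec_injective_iff_isUnit.mpr hw
    simp only [← Matrix.mulVec_mulVec, hv, Matrix.mulVec_zero]
  have key : ∀ u v : Fin p → ℝ, ∀ r : Fin K → ℝ,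
      v ⬝ᵥ (Xᵀ *ᵥ (Matrix.diagonal wbpe *ᵥ r)) = ∑ k, wbpe k * (r k * (X *ᵥ v) k) := by
    intro u v r
    rw [Matrix.dotProduct_mulVec, Matrix.vecMul_transpose]
    simp only [dotProduct, Matrix.mulVec_diagonal]
    refine Finset.sum_congr rfl fun k _ => ?_
    ring
  have hM : IsUnit (Xᵀ * Matrix.diagonal wbpe * X) := by
    rw [← Matrix.mulVec_injective_iff_isUnit]
    rw [← Matrix.coe_mulVecLin, ← LinearMap.ker_eq_bot, LinearMap.ker_eq_bot']
    intro v hv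
    rw [Matrix.mulVecLin_apply, ← Matrix.mulVec_mulVec, ← Matrix.mulVec_mulVec] at hv
    have h := key v v (X *ᵥ v)
    rw [hv, dotProduct_zero] at h
    apply hXinj
    have h2 := (Finset.sum_eq_zero_iff_of_nonneg (fun k _ =>
      mul_nonneg (hw0 k).le (mul_self_nonneg ((X *ᵥ v) k)))).mp h.symm
    funext k
    have h3 := h2 k (Finset.mem_univ k)
    simpa [(hw0 k).ne'] using h3
  have hM' := (Matrix.isUnit_iff_isUnit_det _).mp hM
  rw [hU, hU, quad_aux, quad_aux]
  have hr : ∀ w' : Fin K → ℝ,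
      (X * (Xᵀ * Matrix.diagonal w' * X)⁻¹ * Xᵀ * Matrix.diagonal w' - 1) *ᵥ μvec
      = X *ᵥ ((Xᵀ * Matrix.diagonal w' * X)⁻¹ *ᵥ (Xᵀ *ᵥ (Matrix.diagonal w' *ᵥ μvec)))
        - μvec := by
    intro w'
    simp only [Matrix.sub_mulVec, Matrix.one_mulVec, ← Matrix.mulVec_mulVec]
  rw [hr, hr]
  generalize (Xᵀ * Matrix.diagonal w * X)⁻¹ *ᵥ (Xᵀ *ᵥ (Matrix.diagonal w *ᵥ μvec)) = b
  obtain ⟨a, ha⟩ : ∃ a, a = (Xᵀ * Matrix.diagonal wbpe * X)⁻¹ *ᵥ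
    (Xᵀ *ᵥ (Matrix.diagonal wbpe *ᵥ μvec)) := ⟨_, rfl⟩
  rw [← ha]
  have hn : Xᵀ *ᵥ (Matrix.diagonal wbpe *ᵥ (X *ᵥ a - μvec)) = 0 := by
    rw [Matrix.mulVec_sub, Matrix.mulVec_sub, sub_eq_zero]
    have : Xᵀ *ᵥ (Matrix.diagonal wbpe *ᵥ (X *ᵥ a))
        = (Xᵀ * Matrix.diagonal wbpe * X) *ᵥ a := by
      simp only [← Matrix.mulVec_mulVec]
    rw [this, ha, Matrix.mulVec_mulVec, Matrix.mul_nonsing_inv _ hM', Matrix.one_mulVec]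
  have hc := key a (b - a) (X *ᵥ a - μvec)
  rw [hn, dotProduct_zero] at hc
  have hc2 : ∑ k, B k ^ 2 * ((X *ᵥ a - μvec) k * (X *ᵥ (b - a)) k) = 0 := by
    have : ∀ k, B k ^ 2 * ((X *ᵥ a - μvec) k * (X *ᵥ (b - a)) k)
      = (∑ j, B j ^ 2) * (wbpe k * ((X *ᵥ a - μvec) k * (X *ᵥ (b - a)) k)) := fun k => by
        rw [hBw k]; ring
    rw [Finset.sum_congr rfl fun k _ => this k, ← Finset.mul_sum, ← hc, mul_zero]
  have hfin : ∑ k, B k ^ 2 * (X *ᵥ b - μvec) k ^ 2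
      = ∑ k, B k ^ 2 * (X *ᵥ a - μvec) k ^ 2
        + 2 * ∑ k, B k ^ 2 * ((X *ᵥ a - μvec) k * (X *ᵥ (b - a)) k)
        + ∑ k, B k ^ 2 * (X *ᵥ (b - a)) k ^ 2 := by
    rw [Finset.mul_sum, ← Finset.sum_add_distrib, ← Finset.sum_add_distrib]
    refine Finset.sum_congr rfl fun k _ => ?_
    rw [Matrix.mulVec_sub]
    simp only [Pi.sub_apply]
    ring
  have hnn : 0 ≤ ∑ k, B k ^ 2 * (X *ᵥ (b - a)) k ^ 2 :=
    Finset.sum_nonneg fun k _ => by positivity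
  rw [hfin, hc2]
  linarith
end

section
/- For τ fixed at the true variance component value τ₀, the variance term of the MSPE decomposition is minimized over weight vectors by the MLE weights: tr{(U_{w^{mle}(τ₀),τ₀} + I) V_{Y|θ} (U_{w^{mle}(τ₀),τ₀} + I)ᵀ} + τ₀²·tr{U_{w^{mle}(τ₀),τ₀}ᵀU_{w^{mle}(τ₀),τ₀}} ≤ tr{(U_{w,τ₀} + I) V_{Y|θ} (U_{w,τ₀} + I)ᵀ} + τ₀²·tr{U_{w,τ₀}ᵀU_{w,τ₀}} for every admissible weight vector w, where w^{mle}(τ) has entries proportional to 1/(σ_k² + τ²). -/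
open Matrix

/-- For `τ` fixed at the true variance component `τ₀`, the variance term of
the MSPE decomposition is minimized over admissible weight vectors by the MLE weights. -/
theorem mle_weights_minimize_variance_term
    {K p : ℕ} (hK : 1 ≤ K)
    (σ2 : Fin K → ℝ) (hσ2 : ∀ k, 0 < σ2 k)
    (τ₀ : ℝ) (hτ₀ : 0 ≤ τ₀)
    (X : Matrix (Fin K) (Fin p) ℝ) (hX : X.rank = p)
    (B : Fin K → ℝ) (hB : ∀ k, B k = σ2 k / (σ2 k + τ₀ ^ 2))
    (Bτ VY : Matrix (Fin K) (Fin K) ℝ)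
    (hBτ : Bτ = Matrix.diagonal B) (hVY : VY = Matrix.diagonal σ2)
    (U : (Fin K → ℝ) → Matrix (Fin K) (Fin K) ℝ)
    (hU : ∀ w, U w =
      Bτ * (X * (Xᵀ * Matrix.diagonal w * X)⁻¹ * Xᵀ * Matrix.diagonal w - 1))
    (wmle : Fin K → ℝ)
    (hwmle : ∀ k, wmle k = (σ2 k + τ₀ ^ 2)⁻¹ / ∑ j, (σ2 j + τ₀ ^ 2)⁻¹) :
    ∀ w : Fin K → ℝ, (∀ k, 0 ≤ w k) → IsUnit (Xᵀ * Matrix.diagonal w * X) →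
      ((U wmle + 1) * VY * (U wmle + 1)ᵀ).trace
          + τ₀ ^ 2 * ((U wmle)ᵀ * U wmle).trace ≤
        ((U w + 1) * VY * (U w + 1)ᵀ).trace
          + τ₀ ^ 2 * ((U w)ᵀ * U w).trace := by
  intro w hw hu
  have hs : ∀ k, 0 < σ2 k + τ₀ ^ 2 := fun k => by have := hσ2 k; positivity
  have hsum : 0 < ∑ j, (σ2 j + τ₀ ^ 2)⁻¹ :=
    Finset.sum_pos (fun j _ => inv_pos.2 (hs j)) ⟨⟨0, hK⟩, Finset.mem_univ _⟩
  have hwm : ∀ k, 0 < wmle k := fun k => by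
    rw [hwmle]; exact div_pos (inv_pos.2 (hs k)) hsum
  have hinj : Function.Injective X.mulVec := by
    have h2 := Matrix.mulVec_injective_of_isUnit hu
    intro a b hab
    apply h2
    simp only [← Matrix.mulVec_mulVec]
    rw [show X *ᵥ a = X *ᵥ b from hab]
  have hum : IsUnit (Xᵀ * Matrix.diagonal wmle * X) := by
    have h := (Matrix.PosDef.diagonal hwm).conjTranspose_mul_mul_same hinj
    rw [Matrix.conjTranspose_eq_transpose_of_trivial] at h
    exact h.isUnit
  obtain ⟨S, hS⟩ : ∃ S, S = Matrix.diagonal (fun k => σ2 k + τ₀ ^ 2) := ⟨_, rfl⟩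
  have hSV : S = VY + (τ₀ ^ 2) • (1 : Matrix (Fin K) (Fin K) ℝ) := by
    rw [hS, hVY, ← Matrix.diagonal_one, ← Matrix.diagonal_smul, Matrix.diagonal_add]
    congr 1; ext k; simp
  have hSB : S * Bτ = VY := by
    rw [hS, hBτ, hVY, Matrix.diagonal_mul_diagonal]
    congr 1; ext k; rw [hB]; have := (hs k).ne'; field_simp
  have hSW : S * Matrix.diagonal wmle
      = (∑ j, (σ2 j + τ₀ ^ 2)⁻¹)⁻¹ • (1 : Matrix (Fin K) (Fin K) ℝ) := by
    rw [hS, Matrix.diagonal_mul_diagonal, ← Matrix.diagonal_one, ← Matrix.diagonal_smul]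
    congr 1; ext k; rw [hwmle]; have := (hs k).ne'; have := hsum.ne'
    simp only [Pi.smul_apply, smul_eq_mul, mul_one]
    rw [div_eq_mul_inv, mul_inv_cancel_left₀ (hs k).ne']
  have hVt : VYᵀ = VY := by rw [hVY, Matrix.diagonal_transpose]
  have hSt : Sᵀ = S := by rw [hS, Matrix.diagonal_transpose]
  have hBt : Bτᵀ = Bτ := by rw [hBτ, Matrix.diagonal_transpose]
  have hUX : ∀ v, IsUnit (Xᵀ * Matrix.diagonal v * X) → U v * X = 0 := by
    intro v hv
    rw [hU, Matrix.mul_assoc, Matrix.sub_mul, Matrix.one_mul]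
    have : X * (Xᵀ * Matrix.diagonal v * X)⁻¹ * Xᵀ * Matrix.diagonal v * X
        = X * ((Xᵀ * Matrix.diagonal v * X)⁻¹ * (Xᵀ * Matrix.diagonal v * X)) := by
      simp only [Matrix.mul_assoc]
    rw [this, Matrix.nonsing_inv_mul _ ((Matrix.isUnit_iff_isUnit_det _).1 hv),
      Matrix.mul_one, sub_self, Matrix.mul_zero]
  have hF : ∀ A : Matrix (Fin K) (Fin K) ℝ,
      ((A + 1) * VY * (A + 1)ᵀ).trace + τ₀ ^ 2 * (Aᵀ * A).trace
        = (A * S * Aᵀ).trace + 2 * (A * VY).trace + VY.trace := by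
    intro A
    have h1 : (VY * Aᵀ).trace = (A * VY).trace := by
      rw [← Matrix.trace_transpose, Matrix.transpose_mul, Matrix.transpose_transpose, hVt]
    rw [Matrix.trace_mul_comm Aᵀ A, hSV]
    simp only [Matrix.transpose_add, Matrix.transpose_one, Matrix.add_mul, Matrix.mul_add,
      Matrix.one_mul, Matrix.mul_one, Matrix.trace_add, Matrix.mul_smul, Matrix.smul_mul,
      Matrix.trace_smul, smul_eq_mul, h1]
    ring
  obtain ⟨D, hD⟩ : ∃ D, D = U w - U wmle := ⟨_, rfl⟩
  have hDX : D * X = 0 := by rw [hD, Matrix.sub_mul, hUX w hu, hUX wmle hum, sub_zero]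
  have hUw : U w = U wmle + D := by rw [hD]; abel
  have hcross : D * S * (U wmle)ᵀ + D * VY = 0 := by
    have h1 : S * (U wmle)ᵀ = (∑ j, (σ2 j + τ₀ ^ 2)⁻¹)⁻¹ •
        (X * ((X * (Xᵀ * Matrix.diagonal wmle * X)⁻¹)ᵀ * Bτ)) - VY := by
      rw [hU wmle, Matrix.transpose_mul, hBt, Matrix.transpose_sub, Matrix.transpose_one,
        Matrix.sub_mul, Matrix.mul_sub, Matrix.one_mul, hSB,
        Matrix.transpose_mul _ (Matrix.diagonal wmle), Matrix.diagonal_transpose,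
        Matrix.mul_assoc (Matrix.diagonal wmle), ← Matrix.mul_assoc S, hSW,
        Matrix.smul_mul, Matrix.one_mul, Matrix.transpose_mul _ Xᵀ,
        Matrix.transpose_transpose, Matrix.mul_assoc X]
    rw [Matrix.mul_assoc, h1, Matrix.mul_sub, Matrix.mul_smul, ← Matrix.mul_assoc D X, hDX,
      Matrix.zero_mul, smul_zero]
    abel
  have hpos : 0 ≤ (D * S * Dᵀ).trace := by
    have h0 : S.PosSemidef := by
      rw [hS]; exact Matrix.PosSemidef.diagonal (fun k => (hs k).le)
    have h := h0.mul_mul_conjTranspose_same D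
    rw [Matrix.conjTranspose_eq_transpose_of_trivial] at h
    exact h.trace_nonneg
  have hct : (D * S * (U wmle)ᵀ).trace + (D * VY).trace = 0 := by
    rw [← Matrix.trace_add, hcross, Matrix.trace_zero]
  have hsym : (U wmle * S * Dᵀ).trace = (D * S * (U wmle)ᵀ).trace := by
    rw [← Matrix.trace_transpose]
    simp only [Matrix.transpose_mul, Matrix.transpose_transpose, hSt, Matrix.mul_assoc]
  rw [hF, hF, hUw]
  simp only [Matrix.transpose_add, Matrix.add_mul, Matrix.mul_add, Matrix.trace_add, hsym]
  linarith
end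

section
/- Fix τ ≥ 0 and suppose Σ_k w_k⁰(τ)Y_k ≠ Σ_k w_k¹(τ)Y_k. Then the value of α ∈ [0,1] minimizing M̂_{K,g,0}(w^c(α,τ), τ) is α_opt(τ) = 0 if C₂(τ) ≤ 0, α_opt(τ) = 1 if C₁(τ) ≤ C₂(τ), and α_opt(τ) = C₂(τ)/C₁(τ) otherwise, where C₁(τ) = (B_{·τ}²/K²)·(Σ_j {w_j¹(τ) − w_j⁰(τ)}Y_j)² and C₂(τ) = (B_{·τ}/K²)·(Σ_j {w_j¹(τ) − w_j⁰(τ)}Y_j)·(Σ_k B_{k,τ}[Y_k − Σ_j w_j⁰(τ)Y_j]) − (B_{·τ}σ²/K²)·Σ_k {w_k¹(τ) − w_k⁰(τ)}/n_k. That is, M̂_{K,g,0}(w^c(α_opt(τ),τ), τ) ≤ M̂_{K,g,0}(w^c(α,τ), τ) for all α ∈ [0,1]. -/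
/-- For fixed `τ ≥ 0`, the minimizer over `α ∈ [0,1]` of the population-mean
risk estimate `M̂_{K,g,0}(w^c(α,τ), τ)` is given by the closed form `α_opt(τ)`. -/
theorem optimal_compromise_parameter_population_mean
    {K : ℕ} (hK : 1 ≤ K)
    (Y n : Fin K → ℝ) (hn : ∀ k, 0 < n k)
    (σ2 : ℝ) (hσ2 : 0 < σ2)
    (τ : ℝ) (hτ : 0 ≤ τ)
    (B : Fin K → ℝ) (hB : ∀ k, B k = σ2 / (σ2 + n k * τ ^ 2))
    (Bdot : ℝ) (hBdot : Bdot = ∑ k, B k)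
    (nddot : ℝ) (hnddot : nddot = ((K : ℝ)⁻¹ * ∑ k, (n k)⁻¹)⁻¹)
    -- the risk estimate as a function of the weight vector
    (Mhat : (Fin K → ℝ) → ℝ)
    (hMhat : ∀ w, Mhat w =
      ((K : ℝ)⁻¹ * ∑ k, B k * Y k - Bdot / K * ∑ j, w j * Y j) ^ 2
        + 2 * Bdot * σ2 / (K : ℝ) ^ 2 * ∑ k, w k / n k
        - 2 / (K : ℝ) ^ 2 * ∑ k, σ2 ^ 2 / (n k * (σ2 + n k * τ ^ 2))
        + σ2 / (K * nddot))
    -- two weighting schemes each summing to one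
    (w0 w1 : Fin K → ℝ) (hw0 : ∑ k, w0 k = 1) (hw1 : ∑ k, w1 k = 1)
    (hsep : ∑ k, w0 k * Y k ≠ ∑ k, w1 k * Y k)
    -- compromise weights
    (wc : ℝ → Fin K → ℝ)
    (hwc : ∀ α k, wc α k = α * w1 k + (1 - α) * w0 k)
    -- the constants C₁(τ) and C₂(τ)
    (C1 C2 : ℝ)
    (hC1 : C1 = Bdot ^ 2 / (K : ℝ) ^ 2 * (∑ j, (w1 j - w0 j) * Y j) ^ 2)
    (hC2 : C2 = Bdot / (K : ℝ) ^ 2 * (∑ j, (w1 j - w0 j) * Y j)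
        * (∑ k, B k * (Y k - ∑ j, w0 j * Y j))
      - Bdot * σ2 / (K : ℝ) ^ 2 * ∑ k, (w1 k - w0 k) / n k)
    -- the claimed optimal compromise parameter
    (αopt : ℝ)
    (hαopt : αopt = if C2 ≤ 0 then 0 else if C1 ≤ C2 then 1 else C2 / C1) :
    αopt ∈ Set.Icc (0 : ℝ) 1 ∧
      ∀ α ∈ Set.Icc (0 : ℝ) 1, Mhat (wc αopt) ≤ Mhat (wc α) := by
  have hquad : ∀ α, Mhat (wc α) = Mhat w0 + C1 * α ^ 2 - 2 * C2 * α := by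
    intro α
    have e1 : ∑ j, wc α j * Y j = ∑ j, w0 j * Y j + α * ∑ j, (w1 j - w0 j) * Y j := by
      rw [Finset.mul_sum, ← Finset.sum_add_distrib]
      refine Finset.sum_congr rfl fun k _ => ?_
      rw [hwc]; ring
    have e2 : ∑ j, wc α j / n j = ∑ j, w0 j / n j + α * ∑ j, (w1 j - w0 j) / n j := by
      rw [Finset.mul_sum, ← Finset.sum_add_distrib]
      refine Finset.sum_congr rfl fun k _ => ?_
      rw [hwc]; ring
    have e3 : ∑ k, B k * (Y k - ∑ j, w0 j * Y j)
        = ∑ k, B k * Y k - Bdot * ∑ j, w0 j * Y j := by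
      rw [hBdot, Finset.sum_mul, ← Finset.sum_sub_distrib]
      refine Finset.sum_congr rfl fun k _ => ?_
      ring
    rw [hMhat, hMhat, hC1, hC2, e1, e2, e3]
    ring
  have hC1n : 0 ≤ C1 := by rw [hC1]; positivity
  by_cases h1 : C2 ≤ 0
  · rw [if_pos h1] at hαopt
    subst hαopt
    refine ⟨by simp, fun α hα => ?_⟩
    rw [hquad, hquad]
    have := mul_nonneg hC1n (sq_nonneg α)
    have := mul_nonneg (neg_nonneg.2 h1) hα.1
    linarith
  · rw [if_neg h1] at hαopt
    push Not at h1
    by_cases h2 : C1 ≤ C2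
    · rw [if_pos h2] at hαopt
      subst hαopt
      refine ⟨by simp, fun α hα => ?_⟩
      rw [hquad, hquad]
      have ha : 0 ≤ 1 - α := sub_nonneg.2 hα.2
      have := mul_nonneg hC1n (mul_nonneg ha ha)
      have := mul_nonneg (sub_nonneg.2 h2) ha
      linarith
    · rw [if_neg h2] at hαopt
      push Not at h2
      have hp : 0 < C1 := h1.trans h2
      have hc : C2 = C1 * αopt := by rw [hαopt]; field_simp
      refine ⟨⟨?_, ?_⟩, fun α _ => ?_⟩
      · rw [hαopt]; positivity
      · rw [hαopt, div_le_one hp]; exact h2.le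
      · rw [hquad, hquad, hc]
        have := mul_nonneg hC1n (sq_nonneg (α - αopt))
        linarith
end

section
/- Take τ = 0, minimum-variance weights w_k¹ = n_k/(K·n̄), and direct-estimate weights w_k⁰ = 1/K, and suppose μ̂^{MV} ≠ μ̂^{direct}. Then the value of α ∈ [0,1] minimizing M̂_{K,g,0}(w^c(α,0), 0) is α_opt(0) = min{ max{ σ²(n̄ − n̈)/(K·n̄·n̈·(μ̂^{MV} − μ̂^{direct})²), 0}, 1}. -/
/-- For `τ = 0`, combining the minimum-variance and direct-estimate weights,
the minimizer over `α ∈ [0,1]` of the risk estimate has the stated closed form. -/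
theorem optimal_compromise_minvar_direct
    {K : ℕ} (hK : 1 ≤ K)
    (Y n : Fin K → ℝ) (hn : ∀ k, 0 < n k)
    (σ2 : ℝ) (hσ2 : 0 < σ2)
    -- arithmetic and harmonic means of the sample sizes
    (nbar nddot : ℝ)
    (hnbar : nbar = (K : ℝ)⁻¹ * ∑ k, n k)
    (hnddot : nddot = ((K : ℝ)⁻¹ * ∑ k, (n k)⁻¹)⁻¹)
    -- direct and minimum-variance estimators
    (μdirect μMV : ℝ)
    (hμdirect : μdirect = (K : ℝ)⁻¹ * ∑ k, Y k)
    (hμMV : μMV = ((K : ℝ) * nbar)⁻¹ * ∑ k, Y k * n k)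
    (hsep : μMV ≠ μdirect)
    -- the risk estimate at τ = 0 (where B_{k,0} = 1 and B_{·0} = K)
    (Mhat : (Fin K → ℝ) → ℝ)
    (hMhat : ∀ w, Mhat w =
      ((K : ℝ)⁻¹ * ∑ k, Y k - ∑ j, w j * Y j) ^ 2
        + 2 * σ2 / (K : ℝ) * ∑ k, w k / n k
        - 2 * σ2 / (K : ℝ) ^ 2 * ∑ k, (n k)⁻¹
        + σ2 / (K * nddot))
    -- minimum-variance and direct weights and their compromise
    (w0 w1 : Fin K → ℝ)
    (hw0 : ∀ k, w0 k = (K : ℝ)⁻¹)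
    (hw1 : ∀ k, w1 k = n k / ((K : ℝ) * nbar))
    (wc : ℝ → Fin K → ℝ)
    (hwc : ∀ α k, wc α k = α * w1 k + (1 - α) * w0 k)
    -- the claimed optimal compromise parameter
    (αopt : ℝ)
    (hαopt : αopt =
      min (max (σ2 * (nbar - nddot) /
        ((K : ℝ) * nbar * nddot * (μMV - μdirect) ^ 2)) 0) 1) :
    αopt ∈ Set.Icc (0 : ℝ) 1 ∧
      ∀ α ∈ Set.Icc (0 : ℝ) 1, Mhat (wc αopt) ≤ Mhat (wc α) := by
  have hKpos : (0 : ℝ) < K := by exact_mod_cast hK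
  haveI : Nonempty (Fin K) := ⟨⟨0, hK⟩⟩
  have hnb : 0 < nbar := by
    rw [hnbar]
    exact mul_pos (inv_pos.2 hKpos)
      (Finset.sum_pos (fun k _ => hn k) Finset.univ_nonempty)
  have hnd : 0 < nddot := by
    rw [hnddot]
    exact inv_pos.2 (mul_pos (inv_pos.2 hKpos)
      (Finset.sum_pos (fun k _ => inv_pos.2 (hn k)) Finset.univ_nonempty))
  have hndi : (K : ℝ)⁻¹ * ∑ k, (n k)⁻¹ = nddot⁻¹ := by rw [hnddot, inv_inv]
  have hD : 0 < (μMV - μdirect) ^ 2 := by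
    have := sub_ne_zero.2 hsep
    positivity
  have h1 : ∀ α, ∑ j, wc α j * Y j = α * μMV + (1 - α) * μdirect := by
    intro α
    rw [hμMV, hμdirect]
    simp only [Finset.mul_sum]
    rw [← Finset.sum_add_distrib]
    refine Finset.sum_congr rfl fun k _ => ?_
    rw [hwc, hw0, hw1]
    ring
  have h2 : ∀ α, ∑ k, wc α k / n k = α * nbar⁻¹ + (1 - α) * nddot⁻¹ := by
    intro α
    have h3 : nbar⁻¹ = ∑ _k : Fin K, ((K : ℝ) * nbar)⁻¹ := by
      simp
      field_simp
    rw [← hndi, h3]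
    simp only [Finset.mul_sum]
    rw [← Finset.sum_add_distrib]
    refine Finset.sum_congr rfl fun k _ => ?_
    rw [hwc, hw0, hw1]
    have := (hn k).ne'
    field_simp
  set c := σ2 * (nbar - nddot) / ((K : ℝ) * nbar * nddot * (μMV - μdirect) ^ 2) with hc
  have hcD : c * (μMV - μdirect) ^ 2 = σ2 / K * (nddot⁻¹ - nbar⁻¹) := by
    rw [hc]
    have := sub_ne_zero.2 hsep
    field_simp
  have hdiff : ∀ α β, Mhat (wc α) - Mhat (wc β)
      = (μMV - μdirect) ^ 2 * ((α - c) ^ 2 - (β - c) ^ 2) := by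
    intro α β
    rw [hMhat, hMhat, h1, h1, h2, h2, ← hμdirect]
    linear_combination (2 * (α - β)) * hcD
  have hmem : αopt ∈ Set.Icc (0 : ℝ) 1 := by
    rw [hαopt]
    exact ⟨le_min (le_max_right _ _) zero_le_one, min_le_right _ _⟩
  refine ⟨hmem, fun α hα => ?_⟩
  obtain ⟨ha0, ha1⟩ := hα
  have key : (αopt - c) ^ 2 ≤ (α - c) ^ 2 := by
    rw [hαopt]
    rcases le_total c 0 with h | h
    · rw [max_eq_right h, min_eq_left zero_le_one]
      nlinarith
    · rw [max_eq_left h]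
      rcases le_total c 1 with h' | h'
      · rw [min_eq_left h']
        nlinarith [sq_nonneg (α - c)]
      · rw [min_eq_right h']
        nlinarith
  have := hdiff α αopt
  have := mul_nonneg hD.le (sub_nonneg.2 key)
  linarith
end

section
/- Let w_{K,max}^c(α,τ) and w_{K,min}^c(α,τ) denote the maximum and minimum entries of the compromise weight vector w^c(α,τ). Then for every K ≥ 1, sup over α ∈ [0,1] and τ ≥ 0 of (w_{K,max}^c(α,τ)/w_{K,min}^c(α,τ))^{1/2} is at most 2σ_{max,K}²/σ_{min,K}² + 1, where σ_{max,K}² = max{σ_1²,…,σ_K²} and σ_{min,K}² = min{σ_1²,…,σ_K²}. -/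
/-- The ratio of the largest to the smallest compromise weight is uniformly
bounded: for every `α ∈ [0,1]` and `τ ≥ 0`,
`√(w_max^c(α,τ)/w_min^c(α,τ)) ≤ 2σ²_max/σ²_min + 1`. -/
theorem compromise_weight_ratio_bound
    {K : ℕ} [NeZero K] (hK : 1 ≤ K)
    (σ2 : Fin K → ℝ) (hσ2 : ∀ k, 0 < σ2 k)
    (B : ℝ → Fin K → ℝ) (hB : ∀ τ k, B τ k = σ2 k / (σ2 k + τ ^ 2))
    (wmle wbpe : ℝ → Fin K → ℝ)
    (hwmle : ∀ τ k, wmle τ k = (σ2 k + τ ^ 2)⁻¹ / ∑ j, (σ2 j + τ ^ 2)⁻¹)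
    (hwbpe : ∀ τ k, wbpe τ k = B τ k ^ 2 / ∑ j, B τ j ^ 2)
    (wc : ℝ → ℝ → Fin K → ℝ)
    (hwc : ∀ α τ k, wc α τ k = α * wmle τ k + (1 - α) * wbpe τ k)
    (σmax2 σmin2 : ℝ)
    (hσmax2 : σmax2 = Finset.univ.sup' Finset.univ_nonempty σ2)
    (hσmin2 : σmin2 = Finset.univ.inf' Finset.univ_nonempty σ2) :
    ∀ α ∈ Set.Icc (0 : ℝ) 1, ∀ τ : ℝ, 0 ≤ τ →
      Real.sqrt
          ((Finset.univ.sup' Finset.univ_nonempty (wc α τ)) /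
            (Finset.univ.inf' Finset.univ_nonempty (wc α τ))) ≤
        2 * σmax2 / σmin2 + 1 := by
  intro α hα τ hτ
  obtain ⟨hα0, hα1⟩ := hα
  have hM : ∀ k, σ2 k ≤ σmax2 := fun k => by
    rw [hσmax2]; exact Finset.le_sup' σ2 (Finset.mem_univ k)
  have hm : ∀ k, σmin2 ≤ σ2 k := fun k => by
    rw [hσmin2]; exact Finset.inf'_le σ2 (Finset.mem_univ k)
  have hm0 : 0 < σmin2 := by
    rw [hσmin2, Finset.lt_inf'_iff]; exact fun k _ => hσ2 k
  have hmM : σmin2 ≤ σmax2 := (hm 0).trans (hM 0)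
  have hM0 : 0 < σmax2 := hm0.trans_le hmM
  have ht : 0 ≤ τ ^ 2 := sq_nonneg τ
  have hd : ∀ k, 0 < σ2 k + τ ^ 2 := fun k => by linarith [hσ2 k]
  set R := σmax2 / σmin2 with hR
  have hR1 : 1 ≤ R := (one_le_div hm0).2 hmM
  have hBp : ∀ k, 0 < B τ k := fun k => by rw [hB]; exact div_pos (hσ2 k) (hd k)
  have hSB : 0 < ∑ j, B τ j ^ 2 :=
    Finset.sum_pos (fun j _ => pow_pos (hBp j) 2) Finset.univ_nonempty
  have hSm : 0 < ∑ j, (σ2 j + τ ^ 2)⁻¹ :=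
    Finset.sum_pos (fun j _ => inv_pos.2 (hd j)) Finset.univ_nonempty
  have hmp : ∀ k, 0 < wmle τ k := fun k => by
    rw [hwmle]; exact div_pos (inv_pos.2 (hd k)) hSm
  have hbp : ∀ k, 0 < wbpe τ k := fun k => by
    rw [hwbpe]; exact div_pos (pow_pos (hBp k) 2) hSB
  have hmin : ∀ i, 1 * σmin2 ≤ σ2 i := fun i => by linarith [hm i]
  have hcross : ∀ i j, σ2 i ≤ R * σ2 j := fun i j => by
    calc σ2 i ≤ σmax2 := hM i
      _ = R * σmin2 := by rw [hR]; field_simp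
      _ ≤ R * σ2 j := mul_le_mul_of_nonneg_left (hm j) (by linarith)
  have hinv : ∀ i j, (σ2 i + τ ^ 2)⁻¹ ≤ R * (σ2 j + τ ^ 2)⁻¹ := fun i j => by
    rw [inv_eq_one_div, inv_eq_one_div, mul_one_div, div_le_div_iff₀ (hd i) (hd j)]
    nlinarith [hcross j i, mul_nonneg (sub_nonneg.2 hR1) ht]
  have hBB : ∀ i j, B τ i ≤ R * B τ j := fun i j => by
    rw [hB, hB, ← mul_div_assoc, div_le_div_iff₀ (hd i) (hd j)]
    nlinarith [mul_le_mul_of_nonneg_right (hcross i j) ht,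
      mul_nonneg (sub_nonneg.2 hR1) (mul_pos (hσ2 i) (hσ2 j)).le]
  have h1 : ∀ i j, wmle τ i ≤ R ^ 2 * wmle τ j := fun i j => by
    have : wmle τ i ≤ R * wmle τ j := by
      rw [hwmle, hwmle, ← mul_div_assoc]
      exact div_le_div_of_nonneg_right (hinv i j) hSm.le
    have h2 : R * wmle τ j ≤ R ^ 2 * wmle τ j :=
      mul_le_mul_of_nonneg_right (by nlinarith) (hmp j).le
    exact this.trans h2
  have h2 : ∀ i j, wbpe τ i ≤ R ^ 2 * wbpe τ j := fun i j => by
    rw [hwbpe, hwbpe, ← mul_div_assoc, ← mul_pow]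
    exact div_le_div_of_nonneg_right (pow_le_pow_left₀ (hBp i).le (hBB i j) 2) hSB.le
  have hcp : ∀ k, 0 < wc α τ k := fun k => by
    rw [hwc]
    rcases hα0.eq_or_lt with h | h
    · rw [← h]; linarith [hbp k]
    · exact add_pos_of_pos_of_nonneg (mul_pos h (hmp k))
        (mul_nonneg (by linarith) (hbp k).le)
  have hc : ∀ i j, wc α τ i ≤ R ^ 2 * wc α τ j := fun i j => by
    rw [hwc, hwc]
    have a1 := mul_le_mul_of_nonneg_left (h1 i j) hα0
    have a2 := mul_le_mul_of_nonneg_left (h2 i j) (sub_nonneg.2 hα1)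
    linarith
  obtain ⟨i, _, hi⟩ := Finset.exists_mem_eq_sup' Finset.univ_nonempty (wc α τ)
  obtain ⟨j, _, hj⟩ := Finset.exists_mem_eq_inf' Finset.univ_nonempty (wc α τ)
  rw [hi, hj, mul_div_assoc, ← hR]
  have h3 : Real.sqrt (wc α τ i / wc α τ j) ≤ R :=
    Real.sqrt_le_iff.2 ⟨by linarith, (div_le_iff₀ (hcp j)).2 (hc i j)⟩
  linarith
end

section
/- For every vector Y ∈ ℝ^K, every α ∈ [0,1], and every τ ≥ 0, the oblique projection P_{α,τ} = X(XᵀW^c_{α,τ}X)⁻¹XᵀW^c_{α,τ} satisfies ||P_{α,τ}Y||₂² ≤ (4σ_{max,K}⁴/σ_{min,K}⁴ + 1)·||Y||₂², where σ_{max,K}² = max{σ_1²,…,σ_K²} and σ_{min,K}² = min{σ_1²,…,σ_K²}. -/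
open Matrix

lemma obl_aux {K p : ℕ} (X : Matrix (Fin K) (Fin p) ℝ) (w : Fin K → ℝ) :
    (X * (Xᵀ * Matrix.diagonal w * X)⁻¹ * Xᵀ * Matrix.diagonal w)ᵀ * Matrix.diagonal w *
      (X * (Xᵀ * Matrix.diagonal w * X)⁻¹ * Xᵀ * Matrix.diagonal w) =
    (X * (Xᵀ * Matrix.diagonal w * X)⁻¹ * Xᵀ * Matrix.diagonal w)ᵀ * Matrix.diagonal w := by
  have hGT : (Xᵀ * Matrix.diagonal w * X)ᵀ = Xᵀ * Matrix.diagonal w * X := by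
    simp [Matrix.transpose_mul, Matrix.mul_assoc]
  have hT : (X * (Xᵀ * Matrix.diagonal w * X)⁻¹ * Xᵀ * Matrix.diagonal w)ᵀ =
      Matrix.diagonal w * X * (Xᵀ * Matrix.diagonal w * X)⁻¹ * Xᵀ := by
    rw [Matrix.transpose_mul, Matrix.transpose_mul, Matrix.transpose_mul,
      Matrix.transpose_nonsing_inv, hGT]
    simp [Matrix.mul_assoc]
  rw [hT]
  generalize hG : Xᵀ * Matrix.diagonal w * X = G
  have hGi : G⁻¹ * G * G⁻¹ = G⁻¹ := by
    by_cases h : IsUnit G.det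
    · rw [Matrix.nonsing_inv_mul _ h, Matrix.one_mul]
    · rw [Matrix.nonsing_inv_apply_not_isUnit _ h]; simp
  calc _ = Matrix.diagonal w * X * (G⁻¹ * (Xᵀ * Matrix.diagonal w * X) * G⁻¹) * Xᵀ *
        Matrix.diagonal w := by simp only [Matrix.mul_assoc]
    _ = _ := by rw [hG, hGi]

lemma obl_norm {K : ℕ} [NeZero K] (P : Matrix (Fin K) (Fin K) ℝ) (w : Fin K → ℝ)
    (hP : Pᵀ * Matrix.diagonal w * P = Pᵀ * Matrix.diagonal w)
    (hw : ∀ k, 0 < w k) (C : ℝ) (hC : ∀ k j, w k ≤ C * w j) (Y : Fin K → ℝ) :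
    (P *ᵥ Y) ⬝ᵥ (P *ᵥ Y) ≤ C * (Y ⬝ᵥ Y) := by
  have h1 : (P *ᵥ Y) ⬝ᵥ (Matrix.diagonal w *ᵥ (P *ᵥ Y)) =
      (P *ᵥ Y) ⬝ᵥ (Matrix.diagonal w *ᵥ Y) := by
    have := congrArg (fun M => Y ⬝ᵥ (M *ᵥ Y)) hP
    simp only [← Matrix.mulVec_mulVec] at this
    rw [Matrix.dotProduct_mulVec Y Pᵀ, Matrix.dotProduct_mulVec Y Pᵀ,
      Matrix.vecMul_transpose] at this
    exact this
  generalize P *ᵥ Y = z at h1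
  obtain ⟨m, hm⟩ := Finite.exists_min w
  simp only [dotProduct, Matrix.mulVec_diagonal] at h1 ⊢
  have h2 : ∑ k, w k * z k ^ 2 ≤ ∑ k, w k * Y k ^ 2 := by
    have : 0 ≤ ∑ k, w k * (z k - Y k) ^ 2 :=
      Finset.sum_nonneg fun k _ => mul_nonneg (hw k).le (sq_nonneg _)
    have e : ∑ k, w k * (z k - Y k) ^ 2 = (∑ k, z k * (w k * z k)) -
        2 * (∑ k, z k * (w k * Y k)) + ∑ k, w k * Y k ^ 2 := by
      rw [Finset.mul_sum, ← Finset.sum_sub_distrib, ← Finset.sum_add_distrib]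
      exact Finset.sum_congr rfl fun k _ => by ring
    have e2 : ∑ k, w k * z k ^ 2 = ∑ k, z k * (w k * z k) :=
      Finset.sum_congr rfl fun k _ => by ring
    linarith
  have h3 : w m * ∑ k, z k * z k ≤ ∑ k, w k * z k ^ 2 := by
    rw [Finset.mul_sum]
    exact Finset.sum_le_sum fun k _ => by nlinarith [hm k, sq_nonneg (z k)]
  have h4 : ∑ k, w k * Y k ^ 2 ≤ w m * (C * ∑ k, Y k * Y k) := by
    rw [Finset.mul_sum, Finset.mul_sum]
    exact Finset.sum_le_sum fun k _ => by nlinarith [hC k m, sq_nonneg (Y k)]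
  exact le_of_mul_le_mul_left (h3.trans (h2.trans h4)) (hw m)

/-- The oblique projection `P_{α,τ}` built from the compromise weights
satisfies `‖P_{α,τ}Y‖₂² ≤ (4σ⁴_max/σ⁴_min + 1)‖Y‖₂²` for every `Y`, `α ∈ [0,1]`, `τ ≥ 0`. -/
theorem oblique_projection_norm_bound
    {K p : ℕ} [NeZero K] (hK : 1 ≤ K)
    (σ2 : Fin K → ℝ) (hσ2 : ∀ k, 0 < σ2 k)
    (X : Matrix (Fin K) (Fin p) ℝ) (hX : X.rank = p)
    (B : ℝ → Fin K → ℝ) (hB : ∀ τ k, B τ k = σ2 k / (σ2 k + τ ^ 2))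
    (wmle wbpe : ℝ → Fin K → ℝ)
    (hwmle : ∀ τ k, wmle τ k = (σ2 k + τ ^ 2)⁻¹ / ∑ j, (σ2 j + τ ^ 2)⁻¹)
    (hwbpe : ∀ τ k, wbpe τ k = B τ k ^ 2 / ∑ j, B τ j ^ 2)
    (wc : ℝ → ℝ → Fin K → ℝ)
    (hwc : ∀ α τ k, wc α τ k = α * wmle τ k + (1 - α) * wbpe τ k)
    (P : ℝ → ℝ → Matrix (Fin K) (Fin K) ℝ)
    (hP : ∀ α τ, P α τ =
      X * (Xᵀ * Matrix.diagonal (wc α τ) * X)⁻¹ * Xᵀ * Matrix.diagonal (wc α τ))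
    (σmax2 σmin2 : ℝ)
    (hσmax2 : σmax2 = Finset.univ.sup' Finset.univ_nonempty σ2)
    (hσmin2 : σmin2 = Finset.univ.inf' Finset.univ_nonempty σ2) :
    ∀ Y : Fin K → ℝ, ∀ α ∈ Set.Icc (0 : ℝ) 1, ∀ τ : ℝ, 0 ≤ τ →
      (P α τ *ᵥ Y) ⬝ᵥ (P α τ *ᵥ Y) ≤
        (4 * σmax2 ^ 2 / σmin2 ^ 2 + 1) * (Y ⬝ᵥ Y) := by
  intro Y α hα τ hτ
  have ht : 0 ≤ τ ^ 2 := sq_nonneg τ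
  have hmin : ∀ k, σmin2 ≤ σ2 k := fun k => hσmin2 ▸ Finset.inf'_le _ (Finset.mem_univ k)
  have hmax : ∀ k, σ2 k ≤ σmax2 := fun k => hσmax2 ▸ Finset.le_sup' _ (Finset.mem_univ k)
  have hpos : 0 < σmin2 := by
    rw [hσmin2, Finset.lt_inf'_iff]; exact fun k _ => hσ2 k
  have hs : ∀ k, 0 < σ2 k + τ ^ 2 := fun k => by linarith [hσ2 k]
  obtain ⟨R, hR⟩ : ∃ R, R = σmax2 / σmin2 := ⟨_, rfl⟩
  have hle : σmin2 ≤ σmax2 := (hmin 0).trans (hmax 0)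
  have hR1 : 1 ≤ R := by rw [hR, one_le_div hpos]; exact hle
  have hRk : ∀ k j, σ2 k ≤ R * σ2 j := fun k j => by
    have : R * σmin2 = σmax2 := by rw [hR]; field_simp
    nlinarith [hmin j, hmax k]
  have hRR : R ≤ R ^ 2 := by nlinarith
  have hBpos : ∀ k, 0 < B τ k := fun k => by rw [hB]; exact div_pos (hσ2 k) (hs k)
  have hS1 : 0 < ∑ j, (σ2 j + τ ^ 2)⁻¹ :=
    Finset.sum_pos (fun k _ => inv_pos.2 (hs k)) Finset.univ_nonempty
  have hS2 : 0 < ∑ j, B τ j ^ 2 :=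
    Finset.sum_pos (fun k _ => pow_pos (hBpos k) 2) Finset.univ_nonempty
  have hm0 : ∀ k, 0 < wmle τ k := fun k => by
    rw [hwmle]; exact div_pos (inv_pos.2 (hs k)) hS1
  have hb0 : ∀ k, 0 < wbpe τ k := fun k => by
    rw [hwbpe]; exact div_pos (pow_pos (hBpos k) 2) hS2
  have hm1 : ∀ k j, wmle τ k ≤ R ^ 2 * wmle τ j := fun k j => by
    have h : wmle τ k ≤ R * wmle τ j := by
      rw [hwmle, hwmle, ← mul_div_assoc]
      apply div_le_div_of_nonneg_right _ hS1.le
      rw [← div_eq_mul_inv, inv_eq_one_div, div_le_div_iff₀ (hs k) (hs j)]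
      nlinarith [hRk j k]
    nlinarith [hm0 j]
  have hb1 : ∀ k j, wbpe τ k ≤ R ^ 2 * wbpe τ j := fun k j => by
    rw [hwbpe, hwbpe, ← mul_div_assoc]
    apply div_le_div_of_nonneg_right _ hS2.le
    rw [← mul_pow]
    apply pow_le_pow_left₀ (hBpos k).le
    rw [hB, hB, ← mul_div_assoc, div_le_div_iff₀ (hs k) (hs j)]
    have h1 := mul_le_mul_of_nonneg_right (hRk k j) ht
    have h2 : σ2 k * σ2 j ≤ R * (σ2 k * σ2 j) := by
      nlinarith [mul_pos (hσ2 k) (hσ2 j)]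
    nlinarith
  have hα0 := hα.1
  have hα1 : 0 ≤ 1 - α := by linarith [hα.2]
  have hw0 : ∀ k, 0 < wc α τ k := fun k => by
    rw [hwc]
    rcases hα0.eq_or_lt with h | h
    · subst h; simpa using hb0 k
    · exact add_pos_of_pos_of_nonneg (mul_pos h (hm0 k)) (mul_nonneg hα1 (hb0 k).le)
  have hw1 : ∀ k j, wc α τ k ≤ R ^ 2 * wc α τ j := fun k j => by
    rw [hwc, hwc]
    have h1 := mul_le_mul_of_nonneg_left (hm1 k j) hα0
    have h2 := mul_le_mul_of_nonneg_left (hb1 k j) hα1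
    linarith
  have key := obl_norm (P α τ) (wc α τ) (by rw [hP]; exact obl_aux X _) hw0 _ hw1 Y
  have hY : 0 ≤ Y ⬝ᵥ Y := Finset.sum_nonneg fun k _ => mul_self_nonneg (Y k)
  refine key.trans (mul_le_mul_of_nonneg_right ?_ hY)
  rw [mul_div_assoc, ← div_pow, ← hR]
  nlinarith
end

section
/- For every α ∈ [0,1] and every τ ≥ 0, the term S_{4K}(α,τ) = (1/K)·tr{B_τ P_{α,τ} V_{Y|θ}} satisfies |S_{4K}(α,τ)| ≤ ((p/K²)·Σ_{k=1}^K σ_k⁴)^{1/2}. -/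
open Matrix

theorem leverage_aux {K p : ℕ} (X : Matrix (Fin K) (Fin p) ℝ) (hX : X.rank = p)
    (w : Fin K → ℝ) (hw : ∀ k, 0 < w k) :
    (∀ k, 0 ≤ (X * (Xᵀ * Matrix.diagonal w * X)⁻¹ * Xᵀ * Matrix.diagonal w) k k) ∧
    (∀ k, (X * (Xᵀ * Matrix.diagonal w * X)⁻¹ * Xᵀ * Matrix.diagonal w) k k ≤ 1) ∧
    (X * (Xᵀ * Matrix.diagonal w * X)⁻¹ * Xᵀ * Matrix.diagonal w).trace = p := by
  have hinj : Function.Injective X.mulVec := by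
    rw [Matrix.mulVec_injective_iff, linearIndependent_iff_card_eq_finrank_span,
      Set.finrank, ← Matrix.rank_eq_finrank_span_cols, hX, Fintype.card_fin]
  have hpd : (Xᵀ * Matrix.diagonal w * X).PosDef := by
    have := (Matrix.PosDef.diagonal hw).conjTranspose_mul_mul_same hinj
    rwa [Matrix.conjTranspose_eq_transpose_of_trivial] at this
  have hu : IsUnit (Xᵀ * Matrix.diagonal w * X).det :=
    (Matrix.isUnit_iff_isUnit_det _).1 hpd.isUnit
  have hsymM : (Xᵀ * Matrix.diagonal w * X)ᵀ = Xᵀ * Matrix.diagonal w * X := by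
    simp [Matrix.transpose_mul, Matrix.mul_assoc]
  set M := Xᵀ * Matrix.diagonal w * X with hM
  set G := X * M⁻¹ * Xᵀ with hG
  have hsym : Gᵀ = G := by
    rw [hG]
    simp [Matrix.transpose_mul, Matrix.transpose_nonsing_inv, hsymM, Matrix.mul_assoc]
  have hGG : G * Matrix.diagonal w * G = G := by
    calc G * Matrix.diagonal w * G = X * (M⁻¹ * M) * M⁻¹ * Xᵀ := by
          simp only [hG, hM, Matrix.mul_assoc]
      _ = G := by rw [Matrix.nonsing_inv_mul _ hu, Matrix.mul_one]
  have hkey : ∀ k, G k k = ∑ j, w j * G k j ^ 2 := fun k => by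
    conv_lhs => rw [← hGG]
    rw [Matrix.mul_apply]
    refine Finset.sum_congr rfl fun j _ => ?_
    have : G j k = G k j := congrFun (congrFun hsym k) j
    rw [Matrix.mul_diagonal, this]; ring
  have hn : ∀ k, 0 ≤ G k k := fun k => by
    rw [hkey]; exact Finset.sum_nonneg fun j _ => mul_nonneg (hw j).le (sq_nonneg _)
  have hge : ∀ k, w k * G k k ^ 2 ≤ G k k := fun k => by
    conv_rhs => rw [hkey]
    exact Finset.single_le_sum (f := fun j => w j * G k j ^ 2)
      (fun j _ => mul_nonneg (hw j).le (sq_nonneg _)) (Finset.mem_univ k)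
  refine ⟨fun k => ?_, fun k => ?_, ?_⟩
  · rw [Matrix.mul_diagonal]; exact mul_nonneg (hn k) (hw k).le
  · rw [Matrix.mul_diagonal]
    rcases (hn k).eq_or_lt with h | h
    · rw [← h]; simp
    · have := hge k
      by_contra! hc
      nlinarith
  · have : G * Matrix.diagonal w = X * (M⁻¹ * (Xᵀ * Matrix.diagonal w)) := by
      simp only [hG, Matrix.mul_assoc]
    rw [this, Matrix.trace_mul_comm, Matrix.mul_assoc, ← hM, Matrix.nonsing_inv_mul _ hu]
    simp

/-- The term `S_{4K}(α,τ) = (1/K)·tr{B_τ P_{α,τ} V_{Y|θ}}` satisfies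
`|S_{4K}(α,τ)| ≤ ((p/K²)·Σ_k σ_k⁴)^{1/2}` for every `α ∈ [0,1]` and `τ ≥ 0`. -/
theorem S4K_bound
    {K p : ℕ} [NeZero K] (hK : 1 ≤ K)
    (σ2 : Fin K → ℝ) (hσ2 : ∀ k, 0 < σ2 k)
    (VY : Matrix (Fin K) (Fin K) ℝ) (hVY : VY = Matrix.diagonal σ2)
    (X : Matrix (Fin K) (Fin p) ℝ) (hX : X.rank = p)
    (B : ℝ → Fin K → ℝ) (hB : ∀ τ k, B τ k = σ2 k / (σ2 k + τ ^ 2))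
    (wmle wbpe : ℝ → Fin K → ℝ)
    (hwmle : ∀ τ k, wmle τ k = (σ2 k + τ ^ 2)⁻¹ / ∑ j, (σ2 j + τ ^ 2)⁻¹)
    (hwbpe : ∀ τ k, wbpe τ k = B τ k ^ 2 / ∑ j, B τ j ^ 2)
    (wc : ℝ → ℝ → Fin K → ℝ)
    (hwc : ∀ α τ k, wc α τ k = α * wmle τ k + (1 - α) * wbpe τ k)
    (P : ℝ → ℝ → Matrix (Fin K) (Fin K) ℝ)
    (hP : ∀ α τ, P α τ =
      X * (Xᵀ * Matrix.diagonal (wc α τ) * X)⁻¹ * Xᵀ * Matrix.diagonal (wc α τ))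
    (S4K : ℝ → ℝ → ℝ)
    (hS4K : ∀ α τ, S4K α τ =
      (K : ℝ)⁻¹ * (Matrix.diagonal (B τ) * P α τ * VY).trace) :
    ∀ α ∈ Set.Icc (0 : ℝ) 1, ∀ τ : ℝ, 0 ≤ τ →
      |S4K α τ| ≤ Real.sqrt ((p : ℝ) / (K : ℝ) ^ 2 * ∑ k, σ2 k ^ 2) := by
  classical
  intro α hα τ hτ
  have hden : ∀ k, 0 < σ2 k + τ ^ 2 := fun k => by have := hσ2 k; positivity
  have hBpos : ∀ k, 0 < B τ k := fun k => by rw [hB]; exact div_pos (hσ2 k) (hden k)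
  have hB1 : ∀ k, B τ k ≤ 1 := fun k => by
    rw [hB, div_le_one (hden k)]; nlinarith [sq_nonneg τ]
  have hne : (Finset.univ : Finset (Fin K)).Nonempty := Finset.univ_nonempty
  have hm : ∀ k, 0 < wmle τ k := fun k => by
    rw [hwmle]
    exact div_pos (inv_pos.2 (hden k)) (Finset.sum_pos (fun j _ => inv_pos.2 (hden j)) hne)
  have hb : ∀ k, 0 < wbpe τ k := fun k => by
    rw [hwbpe]
    exact div_pos (pow_pos (hBpos k) 2) (Finset.sum_pos (fun j _ => pow_pos (hBpos j) 2) hne)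
  have hw : ∀ k, 0 < wc α τ k := fun k => by
    rw [hwc]
    rcases hα.1.eq_or_lt with h | h
    · rw [← h]; simpa using hb k
    · have h1 := mul_pos h (hm k)
      have h2 := mul_nonneg (sub_nonneg.2 hα.2) (hb k).le
      linarith
  obtain ⟨h0, h1, hs⟩ := leverage_aux X hX (wc α τ) hw
  rw [← hP] at h0 h1 hs
  have htr : (Matrix.diagonal (B τ) * P α τ * VY).trace = ∑ k, σ2 k * (B τ k * P α τ k k) := by
    subst hVY
    simp only [Matrix.trace, Matrix.diag, Matrix.mul_diagonal, Matrix.diagonal_mul]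
    exact Finset.sum_congr rfl fun k _ => by ring
  have hKpos : (0 : ℝ) < K := by exact_mod_cast hK
  apply Real.abs_le_sqrt
  rw [hS4K, htr, mul_pow]
  have hcs := Finset.sum_mul_sq_le_sq_mul_sq Finset.univ σ2 (fun k => B τ k * P α τ k k)
  have hle : ∑ k, (B τ k * P α τ k k) ^ 2 ≤ p := by
    rw [← hs, Matrix.trace]
    refine Finset.sum_le_sum fun k _ => ?_
    have ha : B τ k * P α τ k k ≤ P α τ k k := mul_le_of_le_one_left (h0 k) (hB1 k)
    have hc : 0 ≤ B τ k * P α τ k k := mul_nonneg (hBpos k).le (h0 k)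
    have := h1 k
    simp only [Matrix.diag]
    nlinarith
  have hS : 0 ≤ ∑ k, σ2 k ^ 2 := Finset.sum_nonneg fun k _ => sq_nonneg _
  calc ((K : ℝ)⁻¹) ^ 2 * (∑ k, σ2 k * (B τ k * P α τ k k)) ^ 2
      ≤ ((K : ℝ)⁻¹) ^ 2 * ((∑ k, σ2 k ^ 2) * p) := by
        refine mul_le_mul_of_nonneg_left (hcs.trans ?_) (by positivity)
        exact mul_le_mul_of_nonneg_left hle hS
    _ = _ := by rw [inv_pow]; field_simp
end
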